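/- Let q = r^m where r is an odd prime power and m ≥ 1, and let t be an even integer dividing r−1. Let e be an integer with 0 ≤ e ≤ m−1. If either η(t) = η(−1) = 1, or η(−t) = 1 and e is even, then there exists an MDS self-dual code over F_q of length (t+1)·r^e + 1. -/

import Mathlib

open Finset

/-- The Euclidean dual of a linear code `C ⊆ F^n`. -/
def euclideanDual {F : Type*} [Field F] {n : ℕ} (C : Submodule F (Fin n → F)) :
    Submodule F (Fin n → F) where
  carrier := {x | ∀ c ∈ C, ∑ i, x i * c i = 0}
  add_mem' := by
    intro a b ha hb c hc
    have h : ∑ i, (a + b) i * c i = (∑ i, a i * c i) + ∑ i, b i * c i := by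
      rw [← Finset.sum_add_distrib]
      exact Finset.sum_congr rfl fun i _ => by simp [add_mul]
    simp only [Set.mem_setOf_eq] at *
    rw [h, ha c hc, hb c hc, add_zero]
  zero_mem' := by
    intro c hc
    simp
  smul_mem' := by
    intro r a ha c hc
    have h : ∑ i, (r • a) i * c i = r * ∑ i, a i * c i := by
      rw [Finset.mul_sum]
      exact Finset.sum_congr rfl fun i _ => by simp [mul_assoc]
    simp only [Set.mem_setOf_eq] at *
    rw [h, ha c hc, mul_zero]

/-- Hamming weight of a word. -/
noncomputable def hWeight {F : Type*} [Field F] {n : ℕ} (c : Fin n → F) : ℕ := Nat.card {i : Fin n // c i ≠ 0}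

/-- `C` is an MDS (Euclidean) self-dual code: it equals its Euclidean dual and its
minimum Hamming distance is `n/2 + 1`. -/
def IsMDSSelfDual {F : Type*} [Field F] {n : ℕ} (C : Submodule F (Fin n → F)) : Prop :=
  C = euclideanDual C ∧
  (∀ c ∈ C, c ≠ 0 → n / 2 + 1 ≤ hWeight c) ∧
  (∃ c ∈ C, c ≠ 0 ∧ hWeight c = n / 2 + 1)

open Classical in
/-- The quadratic character `η` of a field: `1` on nonzero squares, `-1` on nonsquares,
`0` at `0`. -/
noncomputable def quadChar (F : Type*) [Field F] (x : F) : ℤ :=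
  if x = 0 then 0 else if IsSquare x then 1 else -1

open Polynomial

section ExtendedReedSolomon

variable {F : Type*} [Field F]

theorem hWeight_add_card_zeros {n : ℕ} [DecidableEq F] (c : Fin n → F) :
    hWeight c + #{i | c i = 0} = n := by
  rw [hWeight, Nat.card_eq_fintype_card, Fintype.card_subtype, add_comm,
    Finset.card_filter_add_card_filter_not, Finset.card_fin]

/-- The standard dot product is nondegenerate, so self-orthogonal codes of half dimension are
self-dual. -/
theorem eq_euclideanDual_of_le {n : ℕ} {C : Submodule F (Fin n → F)}
    (hC : C ≤ euclideanDual C) (hdim : 2 * Module.finrank F C = n) : C = euclideanDual C := by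
  let B : LinearMap.BilinForm F (Fin n → F) := dotProductBilin F F
  have hB : ∀ x y, B x y = ∑ i, x i * y i := fun _ _ => rfl
  have hrefl : B.IsRefl := fun x y h => by
    rw [hB] at h ⊢
    simpa only [mul_comm] using h
  have hnd : B.Nondegenerate := by
    refine (LinearMap.IsRefl.nondegenerate_iff_separatingLeft hrefl).2 fun x hx => ?_
    funext i
    simpa [hB, Pi.single_apply] using hx (Pi.single i 1)
  have hdual : euclideanDual C = B.orthogonal C := by
    ext x
    refine forall₂_congr fun c _ => ?_
    change _ ↔ B c x = 0
    rw [hB]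
    simp only [mul_comm]
  refine Submodule.eq_of_le_of_finrank_eq hC ?_
  have := LinearMap.BilinForm.finrank_orthogonal hnd C
  rw [hdual, this, Module.finrank_fin_fun]
  lia

/-- Evaluation at `a`, column-scaled by `v`, followed by the coefficient of `X ^ d`. -/
def extendedEval {N : ℕ} (a v : Fin N → F) (d : ℕ) : F[X] →ₗ[F] (Fin (N + 1) → F) where
  toFun p := Fin.snoc (α := fun _ => F) (fun i => v i * p.eval (a i)) (p.coeff d)
  map_add' p q := by
    funext i
    refine Fin.lastCases ?_ (fun i => ?_) i <;> simp [mul_add]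
  map_smul' r p := by
    funext i
    refine Fin.lastCases ?_ (fun i => ?_) i <;> simp [mul_left_comm]

theorem extendedEval_castSucc {N : ℕ} (a v : Fin N → F) (d : ℕ) (p : F[X]) (i : Fin N) :
    extendedEval a v d p i.castSucc = v i * p.eval (a i) := by
  simp [extendedEval]

theorem extendedEval_last {N : ℕ} (a v : Fin N → F) (d : ℕ) (p : F[X]) :
    extendedEval a v d p (Fin.last N) = p.coeff d := by
  simp [extendedEval]

theorem card_zeros_extendedEval [DecidableEq F] {N : ℕ} (a : Fin N → F) {v : Fin N → F}
    (hv : ∀ i, v i ≠ 0) (d : ℕ) (p : F[X]) :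
    #{i | extendedEval a v d p i = 0} =
      #{i | p.eval (a i) = 0} + if p.coeff d = 0 then 1 else 0 := by
  simp only [Finset.card_filter, Fin.sum_univ_castSucc, extendedEval_castSucc, extendedEval_last,
    mul_eq_zero, hv, false_or]

theorem card_zeros_extendedEval_le [DecidableEq F] {N : ℕ} {a v : Fin N → F}
    (ha : Function.Injective a) (hv : ∀ i, v i ≠ 0) {d : ℕ} {p : F[X]} (hp : p ≠ 0)
    (hd : p.natDegree ≤ d) :
    #{i | extendedEval a v d p i = 0} ≤ d := by
  have hroots : #{i | p.eval (a i) = 0} ≤ p.natDegree := by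
    rw [← Finset.card_image_of_injective _ ha]
    refine card_le_degree_of_subset_roots fun x hx => ?_
    rw [Finset.mem_val] at hx
    obtain ⟨i, hi, rfl⟩ := Finset.mem_image.1 hx
    exact (mem_roots hp).2 (by simpa using hi)
  rw [card_zeros_extendedEval a hv]
  split_ifs with h
  · have : p.natDegree ≠ d := by
      rintro rfl
      exact hp (leadingCoeff_eq_zero.1 h)
    lia
  · lia

theorem exists_isMDSSelfDual_of_finset [DecidableEq F] {N d : ℕ} (S : Finset F) (hS : #S = N)
    (hN : N = 2 * d + 1)
    (hw : ∀ x ∈ S, ∃ v, v ^ 2 * ∏ y ∈ S.erase x, (x - y) = -1) :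
    ∃ C : Submodule F (Fin (N + 1) → F), IsMDSSelfDual C := by
  let σ : Fin N ≃ S := (S.equivFinOfCardEq hS).symm
  choose! w hw using hw
  let a : Fin N → F := fun i => σ i
  let v : Fin N → F := fun i => w (σ i)
  have ha : Function.Injective a := Subtype.val_injective.comp σ.injective
  have hv : ∀ i, v i ≠ 0 := fun i h => by
    have := hw _ (σ i).2
    rw [show w (σ i) = 0 from h] at this
    simp at this
  let E := extendedEval a v d
  have hmem : ∀ {p : F[X]}, p ∈ degreeLT F (d + 1) → p.natDegree ≤ d := fun hp =>
    natDegree_le_of_degree_le (mem_degreeLE.1 (degreeLT_succ_eq_degreeLE (R := F) (n := d) ▸ hp))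
  have hwt : ∀ p ∈ degreeLT F (d + 1), p ≠ 0 → d + 2 ≤ hWeight (E p) := fun p hp h0 => by
    have h1 := hWeight_add_card_zeros (E p)
    have h2 := card_zeros_extendedEval_le ha hv h0 (hmem hp)
    lia
  have hhalf : (N + 1) / 2 + 1 = d + 2 := by lia
  refine ⟨(degreeLT F (d + 1)).map E, ?_, ?_, ?_⟩
  · refine eq_euclideanDual_of_le ?_ ?_
    · rintro _ ⟨p, hp, rfl⟩ _ ⟨q, hq, rfl⟩
      have hpd := hmem hp
      have hqd := hmem hq
      have hdeg : (p * q).degree < #S := by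
        refine (degree_le_of_natDegree_le (natDegree_mul_le_of_le hpd hqd)).trans_lt ?_
        exact_mod_cast (by lia : d + d < #S)
      have hlag := Lagrange.coeff_eq_sum (s := S) (v := id) Function.injective_id.injOn hdeg
      rw [show #S - 1 = d + d by lia, coeff_mul_add_eq_of_natDegree_le hpd hqd,
        ← Finset.sum_coe_sort, ← σ.sum_comp] at hlag
      rw [Fin.sum_univ_castSucc, extendedEval_last, extendedEval_last, hlag,
        ← Finset.sum_add_distrib]
      refine Finset.sum_eq_zero fun i _ => ?_
      have hi := hw _ (σ i).2
      have hne : ∏ y ∈ S.erase (σ i : F), ((σ i : F) - y) ≠ 0 := fun h => by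
        rw [h] at hi
        simp at hi
      rw [extendedEval_castSucc, extendedEval_castSucc]
      simp only [id, eval_mul]
      change w (σ i) * p.eval (σ i : F) * (w (σ i) * q.eval (σ i : F)) + _ = 0
      field_simp
      linear_combination (p.eval (σ i : F) * q.eval (σ i : F)) * hi
    · have hinj : Function.Injective (E.domRestrict (degreeLT F (d + 1))) := by
        rw [injective_iff_map_eq_zero]
        rintro ⟨p, hp⟩ h
        by_contra h0
        have h1 := hwt p hp (by simpa using h0)
        rw [show E p = 0 from h] at h1
        simp [hWeight] at h1
      rw [← LinearMap.range_domRestrict, LinearMap.finrank_range_of_inj hinj,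
        (degreeLTEquiv F (d + 1)).finrank_eq, Module.finrank_fin_fun]
      lia
  · rintro _ ⟨p, hp, rfl⟩ h0
    rw [hhalf]
    exact hwt p hp fun h => h0 (by rw [h, map_zero])
  · obtain ⟨T, hTS, hT⟩ := Finset.exists_subset_card_eq (s := S) (n := d) (by lia)
    let p := Lagrange.nodal T (id : F → F)
    have hpd : p.natDegree = d := by rw [Lagrange.natDegree_nodal, hT]
    have hmonic : p.Monic := Lagrange.nodal_monic
    have hp : p ∈ degreeLT F (d + 1) := by
      rw [mem_degreeLT, Lagrange.degree_nodal, hT]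
      exact_mod_cast Nat.lt_succ_self d
    have h1 := hWeight_add_card_zeros (E p)
    have h2 := hwt p hp hmonic.ne_zero
    have h3 : d ≤ #{i | E p i = 0} := by
      rw [card_zeros_extendedEval a hv]
      refine le_add_right ?_
      rw [← hT, ← Finset.card_image_of_injective _ ha]
      refine Finset.card_le_card fun x hx => ?_
      refine Finset.mem_image.2 ⟨σ.symm ⟨x, hTS hx⟩, ?_, by simp [a]⟩
      simpa [a] using Lagrange.eval_nodal_at_node (v := id) hx
    refine ⟨E p, ⟨p, hp, rfl⟩, fun h => ?_, by lia⟩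
    rw [h] at h2
    simp [hWeight] at h2

end ExtendedReedSolomon

theorem exists_prod_eq_of_neg_mem {F : Type*} [Field F] [DecidableEq F] (h2 : (2 : F) ≠ 0)
    (s : Finset F) (h0 : 0 ∉ s) (hneg : ∀ x ∈ s, -x ∈ s) :
    ∃ (j : ℕ) (x : F), #s = 2 * j ∧ ∏ y ∈ s, y = (-1) ^ j * x ^ 2 := by
  induction s using Finset.strongInduction with
  | H s ih =>
    obtain rfl | ⟨a, ha⟩ := s.eq_empty_or_nonempty
    · exact ⟨0, 1, by simp⟩
    have ha0 : a ≠ 0 := fun h => h0 (h ▸ ha)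
    have hane : -a ≠ a := fun h => by
      have : 2 * a = 0 := by linear_combination -h
      simp_all
    have hna : -a ∈ s.erase a := Finset.mem_erase.2 ⟨hane, hneg a ha⟩
    obtain ⟨j, x, hj, hx⟩ := ih ((s.erase a).erase (-a))
      ((Finset.erase_ssubset hna).trans (Finset.erase_ssubset ha)) (by simp [h0])
      (fun y hy => by
        simp only [Finset.mem_erase] at hy ⊢
        exact ⟨fun h => hy.2.1 (neg_injective h), fun h => hy.1 (by rw [← h, neg_neg]),
          hneg y hy.2.2⟩)
    refine ⟨j + 1, a * x, ?_, ?_⟩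
    · rw [← Finset.card_erase_add_one ha, ← Finset.card_erase_add_one hna, hj]
      ring
    · rw [← Finset.mul_prod_erase _ _ ha, ← Finset.mul_prod_erase _ _ hna, hx]
      ring

theorem card_insert_zero_nthRootsFinset {K : Type*} [Field K] [DecidableEq K] {t : ℕ} (ht : 0 < t)
    {ζ : K} (hζ : IsPrimitiveRoot ζ t) : #(insert 0 (nthRootsFinset t (1 : K))) = t + 1 := by
  rw [Finset.card_insert_of_notMem, hζ.card_nthRootsFinset]
  simp [mem_nthRootsFinset ht, ht.ne']

theorem prod_sub_insert_zero_nthRootsFinset {K : Type*} [Field K] [DecidableEq K] {t : ℕ}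
    (ht : 0 < t) {ζ : K} (hζ : IsPrimitiveRoot ζ t) {x : K}
    (hx : x ∈ insert 0 (nthRootsFinset t (1 : K))) :
    ∏ y ∈ (insert 0 (nthRootsFinset t (1 : K))).erase x, (x - y) = -1 ∨
      ∏ y ∈ (insert 0 (nthRootsFinset t (1 : K))).erase x, (x - y) = t := by
  have hnodal : Lagrange.nodal (insert 0 (nthRootsFinset t (1 : K))) id = X * (X ^ t - 1) := by
    rw [Lagrange.nodal_eq, Finset.prod_insert (by simp [mem_nthRootsFinset ht, ht.ne']),
      X_pow_sub_one_eq_prod ht hζ]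
    simp
  have h := Lagrange.eval_nodal_derivative_eval_node_eq (v := id) hx
  rw [hnodal, Lagrange.eval_nodal] at h
  simp only [id] at h
  rw [← h]
  obtain rfl | hx := Finset.mem_insert.1 hx
  · left
    simp [ht.ne']
  · right
    rw [mem_nthRootsFinset ht] at hx
    obtain ⟨s, rfl⟩ := Nat.exists_eq_add_of_lt ht
    simp only [zero_add] at hx ⊢
    simp [hx]
    linear_combination (s + 1 : K) * hx

section Translates

variable {K F : Type*} [Field K] [Field F] [Algebra K F]

theorem prod_smul_sub_submodule [Fintype K] (H : Submodule K F) [Fintype H] {g : K} (hg : g ≠ 0) (b : F) :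
    ∏ h : H, (g • b - h) = g • ∏ h : H, (b - h) := by
  have hpow : g ^ Fintype.card H = g := by
    rw [Module.card_eq_pow_finrank (K := K), FiniteField.pow_card_pow]
  calc ∏ h : H, (g • b - h) = ∏ h : H, g • (b - h) := by
        refine (Fintype.prod_equiv (LinearEquiv.smulOfNeZero K H g hg).toEquiv _ _
          fun h => ?_).symm
        simp [smul_sub]
    _ = g • ∏ h : H, (b - h) := by rw [Finset.prod_smul, Finset.prod_const, Finset.card_univ, hpow]

theorem prod_add_smul_sub [Fintype K] (H : Submodule K F) [Fintype H] (h₀ : H) {x y : K} (hxy : x ≠ y)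
    (b : F) :
    ∏ h : H, ((h₀ + x • b) - (h + y • b)) = (x - y) • ∏ h : H, (b - h) := by
  rw [← prod_smul_sub_submodule H (sub_ne_zero.2 hxy)]
  refine Fintype.prod_equiv (Equiv.subRight h₀) _ _ fun h => ?_
  simp [sub_smul]
  ring

/-- The union of the translates `H + x • b` with `x ∈ A`. -/
def translates [DecidableEq F] (H : Submodule K F) [Fintype H] (A : Finset K) (b : F) : Finset F :=
  (A ×ˢ (univ : Finset H)).image fun z => z.2 + z.1 • b

theorem injective_add_smul {H : Submodule K F} {b : F} (hb : b ∉ H) :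
    Function.Injective fun z : K × H => (z.2 : F) + z.1 • b := by
  rintro ⟨x, h⟩ ⟨y, h'⟩ heq
  have hmem : (x - y) • b ∈ H := by
    rw [show (x - y) • b = h' - h by rw [sub_smul]; linear_combination heq]
    exact H.sub_mem h'.2 h.2
  have hxy : x = y := by
    by_contra hne
    exact hb ((H.smul_mem_iff (sub_ne_zero.2 hne)).1 hmem)
  subst hxy
  simpa using heq

theorem card_translates [DecidableEq F] {H : Submodule K F} [Fintype H] (A : Finset K) {b : F}
    (hb : b ∉ H) : #(translates H A b) = #A * Fintype.card H := by
  rw [translates, Finset.card_image_of_injective _ (injective_add_smul hb), Finset.card_product,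
    Finset.card_univ]

theorem prod_sub_translates [Fintype K] [DecidableEq K] [DecidableEq F] {H : Submodule K F} [Fintype H]
    {A : Finset K} {b : F} (hb : b ∉ H) {x : K} (hx : x ∈ A) (h₀ : H) :
    ∏ y ∈ (translates H A b).erase (h₀ + x • b), ((h₀ + x • b) - y) =
      (∏ h ∈ univ.erase (0 : H), (h : F)) *
        ((∏ y ∈ A.erase x, (x - y)) • (∏ h : H, (b - h)) ^ (#A - 1)) := by
  have hset : (A ×ˢ (univ : Finset H)).erase (x, h₀) =
      (({x} : Finset K) ×ˢ univ.erase h₀) ∪ (A.erase x ×ˢ univ) := by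
    ext ⟨y, h⟩
    simp only [Finset.mem_erase, Finset.mem_union, Finset.mem_product, Finset.mem_singleton,
      Finset.mem_univ, ne_eq, Prod.mk.injEq, and_true]
    by_cases hy : y = x
    · subst hy
      simp [hx]
    · simp [hy]
  have hdisj : Disjoint (({x} : Finset K) ×ˢ (univ.erase h₀)) (A.erase x ×ˢ (univ : Finset H)) :=
    Finset.disjoint_product.2 (Or.inl (by simp))
  have hbase : ∏ h ∈ univ.erase h₀, ((h₀ : F) - h) = ∏ h ∈ univ.erase (0 : H), (h : F) :=
    Finset.prod_equiv (Equiv.subLeft h₀) (by simp [sub_eq_zero, eq_comm]) (by simp)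
  rw [translates, ← Finset.image_erase (injective_add_smul hb) _ (x, h₀),
    Finset.prod_image (injective_add_smul hb).injOn, hset, Finset.prod_union hdisj,
    Finset.prod_product, Finset.prod_product, Finset.prod_singleton]
  congr 1
  · rw [← hbase]
    exact Finset.prod_congr rfl fun h _ => by ring
  · rw [Finset.prod_congr rfl fun y hy =>
      prod_add_smul_sub H h₀ (Finset.ne_of_mem_erase hy).symm b, Finset.prod_smul,
      Finset.prod_const, Finset.card_erase_of_mem hx]

end Translates

theorem exists_algebra_field_card_eq {F : Type*} [Field F] [Fintype F] {p k m : ℕ}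
    (hp : p.Prime) (hk : 0 < k) (hF : Fintype.card F = (p ^ k) ^ m) :
    ∃ (K : Type) (_ : Field K) (_ : Fintype K) (_ : Algebra K F),
      Fintype.card K = p ^ k ∧ Module.finrank K F = m := by
  have := Fact.mk hp
  have hchar : CharP F p := by
    rw [← pow_mul] at hF
    exact charP_of_card_eq_prime_pow hF
  let := ZMod.algebra F p
  have hfin : Module.finrank (ZMod p) F = k * m := by
    have h := Module.card_eq_pow_finrank (K := ZMod p) (V := F)
    rw [hF, ZMod.card, ← pow_mul] at h
    exact (Nat.pow_right_injective hp.two_le h).symm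
  obtain ⟨f⟩ := FiniteField.nonempty_algHom_of_finrank_dvd (F := ZMod p) (K := GaloisField p k)
    (L := F) (by rw [GaloisField.finrank p hk.ne', hfin]; exact dvd_mul_right k m)
  let : Fintype (GaloisField p k) := Fintype.ofFinite _
  let := f.toRingHom.toAlgebra
  have hcard : Fintype.card (GaloisField p k) = p ^ k := by
    rw [← Nat.card_eq_fintype_card, GaloisField.card p k hk.ne']
  refine ⟨GaloisField p k, inferInstance, inferInstance, inferInstance, hcard, ?_⟩
  have h := Module.card_eq_pow_finrank (K := GaloisField p k) (V := F)
  rw [hF, hcard] at h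
  exact (Nat.pow_right_injective (Nat.one_lt_pow hk.ne' hp.one_lt) h).symm

theorem exists_submodule_finrank_eq {K V : Type*} [Field K] [AddCommGroup V] [Module K V]
    [FiniteDimensional K V] {e : ℕ} (he : e ≤ Module.finrank K V) :
    ∃ H : Submodule K V, Module.finrank K H = e := by
  let B := Module.finBasis K V
  refine ⟨Submodule.span K (Set.range (B ∘ Fin.castLE he)), ?_⟩
  rw [finrank_span_eq_card (B.linearIndependent.comp _ (Fin.castLE_injective he)),
    Fintype.card_fin]

theorem exists_isPrimitiveRoot_of_dvd {K : Type*} [Field K] [Fintype K] {t : ℕ}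
    (ht : t ∣ Fintype.card K - 1) : ∃ ζ : K, IsPrimitiveRoot ζ t := by
  classical
  obtain ⟨g, hg⟩ := IsCyclic.exists_generator (α := Kˣ)
  have hord : orderOf g = Fintype.card K - 1 := by
    rw [orderOf_eq_card_of_forall_mem_zpowers hg, Nat.card_eq_fintype_card, Fintype.card_units]
  have hpos : 0 < orderOf g := orderOf_pos g
  obtain ⟨s, hs⟩ := ht
  have := (IsPrimitiveRoot.orderOf g).pow hpos (hord.trans (hs.trans (mul_comm t s)))
  exact ⟨_, IsPrimitiveRoot.coe_units_iff.2 this⟩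

theorem isSquare_of_quadChar_eq_one {F : Type*} [Field F] {x : F} (h : quadChar F x = 1) :
    x ≠ 0 ∧ IsSquare x := by
  unfold quadChar at h
  split_ifs at h with h0 hsq <;> simp_all

/-- The product of the nonzero elements of `H` is `(-1) ^ ((|H| - 1) / 2)` times a square; the
exponent is even when `H` has even dimension over a field of odd order. -/
theorem isSquare_prod_erase_zero {K F : Type*} [Field K] [Fintype K] [Field F] [Algebra K F]
    (H : Submodule K F) [Fintype H] [DecidableEq H] (h2 : (2 : F) ≠ 0)
    (hodd : Odd (Fintype.card K))
    (h : IsSquare (-1 : F) ∨ Even (Module.finrank K H)) :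
    IsSquare (∏ h ∈ univ.erase (0 : H), (h : F)) := by
  classical
  obtain ⟨j, x, hj, hx⟩ := exists_prod_eq_of_neg_mem h2
    ((univ.erase (0 : H)).image (Subtype.val : H → F)) (by simp) (by simp)
  rw [Finset.prod_image Subtype.val_injective.injOn] at hx
  rw [hx]
  refine IsSquare.mul ?_ (IsSquare.sq x)
  obtain h | h := h
  · exact h.pow j
  · refine Even.isSquare_pow ?_ _
    rw [Finset.card_image_of_injective _ Subtype.val_injective,
      Finset.card_erase_of_mem (Finset.mem_univ _), Finset.card_univ,
      Module.card_eq_pow_finrank (K := K)] at hj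
    obtain ⟨l, hl⟩ := h
    rw [hl, ← two_mul, pow_mul] at hj
    have hmod : (Fintype.card K ^ 2) ^ l % 4 = 1 := by
      rw [Nat.pow_mod, Nat.pow_mod (Fintype.card K)]
      obtain h | h : Fintype.card K % 4 = 1 ∨ Fintype.card K % 4 = 3 := by
        rw [Nat.odd_iff] at hodd
        lia
      all_goals simp [h]
    rw [Nat.even_iff]
    lia

theorem stmt_4 (r m e t p k : ℕ) (hp : p.Prime) (hpodd : Odd p) (hr : r = p ^ k) (hk : 0 < k)
    (hm : 1 ≤ m) (he : e ≤ m - 1) (ht : Even t) (hdvd : t ∣ r - 1)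
    (F : Type*) [Field F] [Fintype F] (hF : Fintype.card F = r ^ m)
    (hcase : (quadChar F ((t : ℕ) : F) = 1 ∧ quadChar F (-1 : F) = 1) ∨
      (quadChar F (-((t : ℕ) : F)) = 1 ∧ Even e)) :
    ∃ C : Submodule F (Fin ((t + 1) * r ^ e + 1) → F), IsMDSSelfDual C := by
  classical
  subst hr
  obtain ⟨K, _, _, _, hK, hKF⟩ := exists_algebra_field_card_eq hp hk hF
  have hoddK : Odd (Fintype.card K) := hK ▸ hpodd.pow
  have h2 : (2 : F) ≠ 0 := by
    refine Ring.two_ne_zero fun h => ?_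
    have heven := FiniteField.even_card_of_char_two h
    have hodd : Odd (Fintype.card F) := hF ▸ (hpodd.pow.pow)
    rw [Nat.odd_iff] at hodd
    lia
  have ht0 : 0 < t := Nat.pos_of_dvd_of_pos hdvd
    (Nat.sub_pos_of_lt (Nat.one_lt_pow hk.ne' hp.one_lt))
  obtain ⟨ζ, hζ⟩ := exists_isPrimitiveRoot_of_dvd (K := K) (hK.symm ▸ hdvd)
  obtain ⟨H, hH⟩ := exists_submodule_finrank_eq (K := K) (V := F) (e := e) (by lia)
  have hHtop : H < ⊤ := by
    refine lt_top_iff_ne_top.2 fun h => ?_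
    rw [h, finrank_top] at hH
    lia
  obtain ⟨b, -, hb⟩ := SetLike.exists_of_lt hHtop
  have hcardH : Fintype.card H = (p ^ k) ^ e := by
    rw [Module.card_eq_pow_finrank (K := K), hK, hH]
  have htsq : (t : F) ≠ 0 ∧ IsSquare (-(t : F)) := by
    obtain ⟨h, h'⟩ | ⟨h, -⟩ := hcase
    · obtain ⟨h0, hs⟩ := isSquare_of_quadChar_eq_one h
      refine ⟨h0, ?_⟩
      rw [← neg_one_mul]
      exact (isSquare_of_quadChar_eq_one h').2.mul hs
    · obtain ⟨h0, hs⟩ := isSquare_of_quadChar_eq_one h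
      exact ⟨neg_ne_zero.1 h0, hs⟩
  have hcsq := isSquare_prod_erase_zero H h2 hoddK
    (hcase.imp (fun h => (isSquare_of_quadChar_eq_one h.2).2) fun h => hH.symm ▸ h.2)
  have hc0 : ∏ h ∈ univ.erase (0 : H), (h : F) ≠ 0 := Finset.prod_ne_zero_iff.2 (by simp)
  have hb0 : ∏ h : H, (b - h) ≠ 0 := Finset.prod_ne_zero_iff.2 fun h _ h0 =>
    hb (sub_eq_zero.1 h0 ▸ h.2)
  have hcardA := card_insert_zero_nthRootsFinset ht0 hζ
  have hodd : Odd ((t + 1) * (p ^ k) ^ e) := ht.add_one.mul hpodd.pow.pow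
  obtain ⟨d, hd⟩ := hodd
  refine exists_isMDSSelfDual_of_finset
    (translates H (insert 0 (nthRootsFinset t (1 : K))) b)
    (by rw [card_translates _ hb, hcardA, hcardH]) hd fun y hy => ?_
  obtain ⟨⟨x, h₀⟩, hx, rfl⟩ := Finset.mem_image.1 hy
  have hx := (Finset.mem_product.1 hx).1
  simp only at hx ⊢
  rw [prod_sub_translates hb hx, hcardA, Nat.add_sub_cancel]
  set c := ∏ h ∈ univ.erase (0 : H), (h : F)
  set B := ∏ h : H, (b - h)
  suffices h : ∀ u : F, u ≠ 0 → IsSquare (-u) → ∃ v, v ^ 2 * (c * (u * B ^ t)) = -1 by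
    obtain hu | hu := prod_sub_insert_zero_nthRootsFinset ht0 hζ hx <;>
      rw [hu, Algebra.smul_def]
    · exact h _ (by simp) (by simp)
    · exact h _ (by simpa using htsq.1) (by simpa using htsq.2)
  intro u hu0 hu
  obtain ⟨s, hs⟩ := (hcsq.mul (hu.mul (ht.isSquare_pow B)))
  have hs0 : s ≠ 0 := by
    rintro rfl
    simp [hc0, hu0, hb0] at hs
  refine ⟨s⁻¹, ?_⟩
  rw [show c * (u * B ^ t) = -(s * s) by linear_combination -hs]
  field_simp
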